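/- Fix an integer d ≥ 2. For each i ∈ {1,…,2d+7} let α_i = {i, i+1, …, d+i+1}, and let S = ∂(α₁,…,α_{2d+7}) be the resulting linear stacked d-sphere on the vertex set {1,…,3d+8}. Let f = α₁ \ {d+1} and g = α_{2d+7} \ {2d+8}; then f and g are facets of S, and every transversal of the hypergraph of facets of S other than f and g has size at least 6, i.e. τ(S − {f, g}) ≥ 6. -/

import Mathlib

open Finset

/-- `τ` is a face of the partial stacked ball built from the first `k` simplices of `σ`. -/
def memBall {m : ℕ} (σ : Fin m → Finset ℕ) (k : ℕ) (τ : Finset ℕ) : Prop :=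
  ∃ i : Fin m, i.val < k ∧ τ ⊆ σ i

/-- `σ` is a construction sequence `Γ(B) = (σ₁, …, σ_m)` of a stacked `(d+1)`-ball `B`:
each `σ i` is a `(d+2)`-element vertex set (a `(d+1)`-simplex), and each `σ k` (`k > 0`)
is glued to the previously built ball `B_k` along a `(d+1)`-element free face `η` of
`B_k` (a face lying in a unique maximal face), i.e. `B_k ∩ 2^{σ k} = 2^η`. -/
def IsStackedBall (d m : ℕ) (σ : Fin m → Finset ℕ) : Prop :=
  (∀ i : Fin m, (σ i).card = d + 2) ∧
  ∀ k : Fin m, 0 < k.val →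
    ∃ η : Finset ℕ, η.card = d + 1 ∧ η ⊆ σ k ∧
      (∃! i : Fin m, i.val < k.val ∧ η ⊆ σ i) ∧
      (∀ τ : Finset ℕ, τ ⊆ σ k → (memBall σ k.val τ ↔ τ ⊆ η))

/-- The facets of the stacked `d`-sphere `S = ∂(σ₁,…,σ_m)`: the `(d+1)`-element free
faces of the stacked `(d+1)`-ball, i.e. the `(d+1)`-element sets contained in a unique
simplex `σ i`. -/
def sphereFacets (d m : ℕ) (σ : Fin m → Finset ℕ) : Set (Finset ℕ) :=
  {f | f.card = d + 1 ∧ ∃! i : Fin m, f ⊆ σ i}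

/-- The vertex set of the stacked ball `∂(σ₁,…,σ_m)` and of its boundary sphere. -/
def vertexSet (m : ℕ) (σ : Fin m → Finset ℕ) : Finset ℕ :=
  Finset.univ.biUnion σ

/-- `T` is a transversal of the hypergraph `H`: it meets every edge of `H`. -/
def IsTransversal (T : Finset ℕ) (H : Set (Finset ℕ)) : Prop :=
  ∀ e ∈ H, (T ∩ e).Nonempty

/-- The transversal number `τ(H)` of a hypergraph `H`: the minimum size of a transversal. -/
noncomputable def tau (H : Set (Finset ℕ)) : ℕ :=
  sInf {n | ∃ T : Finset ℕ, T.card = n ∧ IsTransversal T H}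

/-- Adjacency in the dual graph `G(B)`: `i ≠ j` and `σ i ∩ σ j` is a `d`-simplex. -/
def DualAdj (d m : ℕ) (σ : Fin m → Finset ℕ) (i j : Fin m) : Prop :=
  i ≠ j ∧ (σ i ∩ σ j).card = d + 1

/-- The dual graph `G(B)` is the path `1 – 2 – ⋯ – m` in this index order. -/
def IsPathOrder (d m : ℕ) (σ : Fin m → Finset ℕ) : Prop :=
  ∀ i j : Fin m, DualAdj d m σ i j ↔ (i.val + 1 = j.val ∨ j.val + 1 = i.val)

/-- The stacked sphere is linear: its dual graph `G(B)` is a path. -/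
def IsLinear (d m : ℕ) (σ : Fin m → Finset ℕ) : Prop :=
  ∃ e : Fin m ≃ Fin m, ∀ i j : Fin m,
    DualAdj d m σ i j ↔ ((e i).val + 1 = (e j).val ∨ (e j).val + 1 = (e i).val)

/-- The sequence `α_i = {i, i+1, …, d+i+1}` for `i ∈ [2d+7]` (here `0`-indexed). -/
def alphaSeq (d : ℕ) : Fin (2 * d + 7) → Finset ℕ :=
  fun i => Finset.Icc (i.val + 1) (i.val + d + 2)

lemma aux_card (d a x : ℕ) (h1 : a ≤ x) (h2 : x ≤ a + d + 1) :
    (Finset.Icc a (a + d + 1) \ {x}).card = d + 1 := by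
  rw [Finset.card_sdiff_of_subset (by simp; omega)]
  simp; omega

lemma aux_facet (d a x : ℕ) (h0 : 1 ≤ a) (hm : a ≤ 2 * d + 7) (h1 : a < x) (h2 : x < a + d + 1) :
    (Finset.Icc a (a + d + 1) \ {x}) ∈ sphereFacets d (2 * d + 7) (alphaSeq d) := by
  refine ⟨aux_card d a x h1.le h2.le, ⟨a - 1, by omega⟩, ?_, ?_⟩
  · intro y hy
    simp [alphaSeq] at hy ⊢
    omega
  · intro j hj
    have e1 := @hj a (by simp; omega)
    have e2 := @hj (a + d + 1) (by simp; omega)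
    simp [alphaSeq] at e1 e2
    apply Fin.ext
    simp
    omega

lemma aux_first (d : ℕ) : Finset.Icc 1 (d + 1) ∈ sphereFacets d (2 * d + 7) (alphaSeq d) := by
  refine ⟨by simp, ⟨0, by omega⟩, ?_, ?_⟩
  · intro y hy
    simp [alphaSeq] at hy ⊢
    omega
  · intro j hj
    have e1 := @hj 1 (by simp)
    simp [alphaSeq] at e1
    apply Fin.ext
    simp
    omega

lemma aux_last (d : ℕ) :
    Finset.Icc (2 * d + 8) (3 * d + 8) ∈ sphereFacets d (2 * d + 7) (alphaSeq d) := by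
  refine ⟨by simp; omega, ⟨2 * d + 6, by omega⟩, ?_, ?_⟩
  · intro y hy
    simp [alphaSeq] at hy ⊢
    omega
  · intro j hj
    have e1 := @hj (3 * d + 8) (by simp; omega)
    simp [alphaSeq] at e1
    apply Fin.ext
    simp
    omega

lemma aux_sum (d a b c : ℕ) (hd : 2 ≤ d) (hab : a < b) (hbc : b < c) (ha : 1 ≤ a)
    (hc : c ≤ 3 * d + 8)
    (H : ∀ i x, a < i → i + d + 1 < c → i < x → x < i + d + 1 →
      i ≤ b ∧ b ≤ i + d + 1 ∧ b ≠ x) :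
    c ≤ a + d + 2 ∨ (c = a + d + 3 ∧ (b = a + 1 ∨ b + 1 = c)) := by
  by_contra hcon
  have key : ∀ i, a < i → i + d + 1 < c → b = i ∨ b = i + d + 1 := by
    intro i h1 h2
    have e1 := H i (i + 1) h1 h2 (by omega) (by omega)
    by_contra hb
    have e2 := H i b h1 h2 (by omega) (by omega)
    omega
  have k1 := key (a + 1) (by omega) (by omega)
  have k2 := key (c - d - 2) (by omega) (by omega)
  have k3 : a + 2 + d + 1 < c → _ := key (a + 2) (by omega)
  omega

lemma aux_five (d t1 t2 t3 t4 t5 : ℕ) (hd : 2 ≤ d) (h0 : 1 ≤ t1) (h12 : t1 < t2) (h23 : t2 < t3)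
    (h34 : t3 < t4) (h45 : t4 < t5) (h5 : t5 ≤ 3 * d + 8)
    (H : ∀ i x, 1 ≤ i → i ≤ 2 * d + 7 → i < x → x < i + d + 1 → (i = 1 → x ≠ d + 1) →
      (i = 2 * d + 7 → x ≠ 2 * d + 8) →
      ∃ t, (t = t1 ∨ t = t2 ∨ t = t3 ∨ t = t4 ∨ t = t5) ∧ i ≤ t ∧ t ≤ i + d + 1 ∧ t ≠ x)
    (hf : t1 ≤ d + 1) (hg : 2 * d + 8 ≤ t5) : False := by
  have s1 := aux_sum d t1 t2 t3 hd h12 h23 h0 (by omega) (by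
    intro i x a1 a2 a3 a4
    obtain ⟨t, ht⟩ := H i x (by omega) (by omega) a3 a4 (by omega) (by omega)
    omega)
  have s2 := aux_sum d t2 t3 t4 hd h23 h34 (by omega) (by omega) (by
    intro i x a1 a2 a3 a4
    obtain ⟨t, ht⟩ := H i x (by omega) (by omega) a3 a4 (by omega) (by omega)
    omega)
  have s3 := aux_sum d t3 t4 t5 hd h34 h45 (by omega) (by omega) (by
    intro i x a1 a2 a3 a4
    obtain ⟨t, ht⟩ := H i x (by omega) (by omega) a3 a4 (by omega) (by omega)
    omega)
  have b1 : t1 = 1 ∨ t1 = d + 1 ∨ t2 ≤ d + 2 := by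
    by_contra hcon
    obtain ⟨t, ht⟩ := H 1 t1 (by omega) (by omega) (by omega) (by omega) (by omega) (by omega)
    omega
  have b2 : t5 = 3 * d + 8 ∨ t5 = 2 * d + 8 ∨ 2 * d + 7 ≤ t4 := by
    by_contra hcon
    obtain ⟨t, ht⟩ := H (2 * d + 7) t5 (by omega) (by omega) (by omega) (by omega)
      (by omega) (by omega)
    omega
  have b3 : t1 = d + 1 → t2 ≤ d + 3 := by
    intro h
    by_contra hcon
    obtain ⟨t, ht⟩ := H 2 t1 (by omega) (by omega) (by omega) (by omega) (by omega) (by omega)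
    omega
  have b4 : t5 = 2 * d + 8 → 2 * d + 6 ≤ t4 := by
    intro h
    by_contra hcon
    obtain ⟨t, ht⟩ := H (2 * d + 6) t5 (by omega) (by omega) (by omega) (by omega)
      (by omega) (by omega)
    omega
  omega

lemma aux_tau (d : ℕ) (hd : 2 ≤ d) (T : Finset ℕ) (hT : IsTransversal T
    (sphereFacets d (2 * d + 7) (alphaSeq d) \
      ({Finset.Icc 1 (d + 2) \ {d + 1},
        Finset.Icc (2 * d + 7) (3 * d + 8) \ {2 * d + 8}} : Set (Finset ℕ)))) : 6 ≤ T.card := by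
  by_contra hlt
  obtain ⟨U, hU1, hU2, hU3⟩ := Finset.exists_subsuperset_card_eq
    (s := T ∩ Finset.Icc 1 (3 * d + 8)) (t := Finset.Icc 1 (3 * d + 8)) (n := 5)
    Finset.inter_subset_right
    (by have := Finset.card_le_card (Finset.inter_subset_left (s₁ := T) (s₂ := Finset.Icc 1 (3 * d + 8))); omega)
    (by simp)
  let φ := U.orderEmbOfFin hU3
  have hmem : ∀ t, t ∈ U → t = φ 0 ∨ t = φ 1 ∨ t = φ 2 ∨ t = φ 3 ∨ t = φ 4 := by
    intro t ht
    have : t ∈ Set.range φ := by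
      rw [Finset.range_orderEmbOfFin]; exact ht
    obtain ⟨j, rfl⟩ := this
    fin_cases j <;> simp
  have hr : ∀ j, 1 ≤ φ j ∧ φ j ≤ 3 * d + 8 := by
    intro j
    have := hU2 (Finset.orderEmbOfFin_mem U hU3 j)
    simpa using this
  have hlt' : ∀ i j : Fin 5, i < j → φ i < φ j := fun i j h => φ.strictMono h
  have h01 := hlt' 0 1 (by decide)
  have h12 := hlt' 1 2 (by decide)
  have h23 := hlt' 2 3 (by decide)
  have h34 := hlt' 3 4 (by decide)
  have hit : ∀ e : Finset ℕ, e ∈ sphereFacets d (2 * d + 7) (alphaSeq d) →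
      e ≠ Finset.Icc 1 (d + 2) \ {d + 1} →
      e ≠ Finset.Icc (2 * d + 7) (3 * d + 8) \ {2 * d + 8} →
      e ⊆ Finset.Icc 1 (3 * d + 8) → ∃ t, t ∈ U ∧ t ∈ e := by
    intro e he h1 h2 h3
    obtain ⟨t, ht⟩ := hT e ⟨he, by simp [h1, h2]⟩
    rw [Finset.mem_inter] at ht
    exact ⟨t, hU1 (Finset.mem_inter.2 ⟨ht.1, h3 ht.2⟩), ht.2⟩
  refine aux_five d (φ 0) (φ 1) (φ 2) (φ 3) (φ 4) hd (hr 0).1 h01 h12 h23 h34 (hr 4).2 ?_ ?_ ?_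
  · intro i x a1 a2 a3 a4 a5 a6
    obtain ⟨t, ht, hte⟩ := hit _ (aux_facet d i x a1 a2 a3 a4)
      (by
        intro h
        have e1 := Finset.ext_iff.1 h 1
        have e2 := Finset.ext_iff.1 h (d + 1)
        simp at e1 e2
        omega)
      (by
        intro h
        have e1 := Finset.ext_iff.1 h (3 * d + 8)
        have e2 := Finset.ext_iff.1 h (2 * d + 8)
        simp at e1 e2
        omega)
      (by intro y hy; simp at hy ⊢; omega)
    simp at hte
    exact ⟨t, hmem t ht, by omega⟩
  · obtain ⟨t, ht, hte⟩ := hit _ (aux_first d)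
      (by
        intro h
        have e2 := Finset.ext_iff.1 h (d + 1)
        simp at e2)
      (by
        intro h
        have e1 := Finset.ext_iff.1 h 1
        simp at e1)
      (by intro y hy; simp at hy ⊢; omega)
    simp at hte
    have := hmem t ht
    omega
  · obtain ⟨t, ht, hte⟩ := hit _ (aux_last d)
      (by
        intro h
        have e2 := Finset.ext_iff.1 h 1
        simp at e2; omega)
      (by
        intro h
        have e1 := Finset.ext_iff.1 h (2 * d + 8)
        simp at e1; omega)
      (by intro y hy; simp at hy ⊢; omega)
    simp at hte
    have := hmem t ht
    omega

/-- **Claim in the proof of the linear lower bound.** For `d ≥ 2`, the sequence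
`(α₁,…,α_{2d+7})` with `α_i = {i,…,d+i+1}` defines a linear stacked `d`-sphere
`S` on `{1,…,3d+8}`, the sets `f = α₁ \ {d+1}` and `g = α_{2d+7} \ {2d+8}` are
facets of `S`, and `τ(S − {f, g}) ≥ 6`. -/
theorem explicit_linear_construction (d : ℕ) (hd : 2 ≤ d) :
    IsStackedBall d (2 * d + 7) (alphaSeq d) ∧
    IsPathOrder d (2 * d + 7) (alphaSeq d) ∧
    vertexSet (2 * d + 7) (alphaSeq d) = Finset.Icc 1 (3 * d + 8) ∧
    (Finset.Icc 1 (d + 2) \ {d + 1}) ∈ sphereFacets d (2 * d + 7) (alphaSeq d) ∧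
    (Finset.Icc (2 * d + 7) (3 * d + 8) \ {2 * d + 8}) ∈
      sphereFacets d (2 * d + 7) (alphaSeq d) ∧
    6 ≤ tau (sphereFacets d (2 * d + 7) (alphaSeq d) \
      ({Finset.Icc 1 (d + 2) \ {d + 1},
        Finset.Icc (2 * d + 7) (3 * d + 8) \ {2 * d + 8}} : Set (Finset ℕ))) := by
  refine ⟨⟨?_, ?_⟩, ?_, ?_, ?_, ?_, ?_⟩
  · intro i; simp [alphaSeq]; omega
  · intro k hk
    have hkm := k.isLt
    refine ⟨Finset.Icc (k.val + 1) (k.val + d + 1), by simp; omega, ?_, ?_, ?_⟩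
    · intro y hy
      simp [alphaSeq] at hy ⊢
      omega
    · refine ⟨⟨k.val - 1, by omega⟩, ⟨by show k.val - 1 < k.val; omega, ?_⟩, ?_⟩
      · intro y hy
        simp [alphaSeq] at hy ⊢
        omega
      · rintro j ⟨hj, hjs⟩
        have e1 := @hjs (k.val + d + 1) (by simp)
        simp [alphaSeq] at e1
        apply Fin.ext
        simp
        omega
    · intro τ hτ
      constructor
      · rintro ⟨i, hi, his⟩ y hy
        have e1 := hτ hy
        have e2 := his hy
        simp [alphaSeq] at e1 e2 ⊢
        omega
      · intro h
        refine ⟨⟨k.val - 1, by omega⟩, by show k.val - 1 < k.val; omega, fun y hy => ?_⟩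
        have e1 := h hy
        simp [alphaSeq] at e1 ⊢
        omega
  · intro i j
    have : alphaSeq d i ∩ alphaSeq d j =
        Finset.Icc (max i.val j.val + 1) (min i.val j.val + d + 2) := by
      ext y; simp [alphaSeq]; omega
    rw [DualAdj, this, Nat.card_Icc, Ne, Fin.ext_iff]
    omega
  · ext y
    simp only [vertexSet, Finset.mem_biUnion, Finset.mem_univ, true_and, alphaSeq, Finset.mem_Icc]
    constructor
    · rintro ⟨i, hi⟩
      have := i.isLt
      omega
    · intro hy
      exact ⟨⟨min (y - 1) (2 * d + 6), by omega⟩, by simp only []; omega⟩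
  · have := aux_facet d 1 (d + 1) (by omega) (by omega) (by omega) (by omega)
    rwa [show 1 + d + 1 = d + 2 by omega] at this
  · have := aux_facet d (2 * d + 7) (2 * d + 8) (by omega) (by omega) (by omega) (by omega)
    rwa [show 2 * d + 7 + d + 1 = 3 * d + 8 by omega] at this
  · unfold tau
    apply le_csInf
    · refine ⟨_, Finset.Icc 1 (3 * d + 8), rfl, ?_⟩
      rintro e ⟨⟨hc, i, hi, -⟩, -⟩
      have hne : e.Nonempty := by rw [← Finset.card_pos]; omega
      obtain ⟨y, hy⟩ := hne
      refine ⟨y, Finset.mem_inter.2 ⟨?_, hy⟩⟩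
      have := hi hy
      have := i.isLt
      simp [alphaSeq] at *
      omega
    · rintro n ⟨T, rfl, hT⟩
      exact aux_tau d hd T hT
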